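/- Let k be a field and F a field generator of A = k[X,Y]. Then F is a bad field generator of A if and only if there exists a ring A' with A ⊆ A', A' = k[U,V] a polynomial ring in two variables, Frac(A') = Frac(A), such that F is a very bad field generator of A'. Moreover, in that case (X',Y') can be chosen with A = k[X',Y'] such that F is a very bad field generator of k[X', Y'/X']. -/

import Mathlib

open MvPolynomial

/-- `F ∈ A = k[X,Y]` (viewed in `L = Frac A`) is a *very bad field generator* of a subring
`B` of `L` (with `Frac B = L`): it is a bad field generator of every polynomial ring `C` in
two variables over `k` with `B ⊆ C ⊆ L` and `Frac C = L`. -/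
def VeryBadIn (k : Type) [Field k] {L : Type} [Field L] [Algebra k L]
    (B : Subalgebra k L) (f : L) : Prop :=
  ∀ C : Subalgebra k L, B ≤ C →
    Nonempty (C ≃ₐ[k] MvPolynomial (Fin 2) k) →
    (∀ x : L, ∃ p q : C, q ≠ 0 ∧ x * (q : L) = (p : L)) →
    ((∃ g : L, IntermediateField.adjoin k {f, g} = ⊤)
      ∧ ¬ ∃ g ∈ C, IntermediateField.adjoin k {f, g} = ⊤)

theorem exists_aeval_eq_of_mem_adjoin_pair {k R : Type*} [CommRing k] [CommRing R] [Algebra k R]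
    {U V a : R} (ha : a ∈ Algebra.adjoin k {U, V}) :
    ∃ f : Polynomial (Algebra.adjoin k {U}), Polynomial.aeval V f = a := by
  rw [← Set.singleton_union, Algebra.adjoin_union_eq_adjoin_adjoin] at ha
  rw [Subalgebra.mem_restrictScalars,
    Algebra.adjoin_singleton_eq_range_aeval (Algebra.adjoin k {U})] at ha
  exact ha

namespace Valuation

variable {Ω Γ : Type*} [Field Ω] [LinearOrderedCommGroupWithZero Γ] (v : Valuation Ω Γ)

theorem aeval_sub_leadingCoeff_lt {S : Type*} [CommRing S] [Algebra S Ω]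
    (hS : ∀ c : S, v (algebraMap S Ω c) ≤ 1) {G : Ω} (hG : 1 < v G) (P : Polynomial S) :
    v (Polynomial.aeval G P - algebraMap S Ω P.leadingCoeff * G ^ P.natDegree)
      < v G ^ P.natDegree := by
  rw [Polynomial.aeval_eq_sum_range, Finset.sum_range_succ, Algebra.smul_def (_ : S),
    Polynomial.coeff_natDegree, add_sub_cancel_right]
  refine v.map_sum_lt (pow_ne_zero _ (zero_lt_one.trans hG).ne') fun i hi => ?_
  rw [Algebra.smul_def, map_mul, map_pow]
  exact mul_lt_of_le_one_of_lt (hS _) (pow_lt_pow_right₀ hG (Finset.mem_range.1 hi))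

variable {k : Type*} [Field k] [Algebra k Ω]

theorem aeval_le_one (hk : ∀ c : k, v (algebraMap k Ω c) ≤ 1)
    {e : Ω} (he : v e ≤ 1) (q : Polynomial k) :
    v (Polynomial.aeval e q) ≤ 1 := by
  rw [Polynomial.aeval_eq_sum_range]
  refine v.map_sum_le fun i _ => ?_
  rw [Algebra.smul_def, map_mul, map_pow]
  exact mul_le_one' (hk _) (pow_le_one' he _)

theorem mul_sub_mul_lt_one {a b c d : Ω} (h₁ : v (a - c) < 1) (h₂ : v (b - d) < 1)
    (ha : v a ≤ 1) (hd : v d ≤ 1) : v (a * b - c * d) < 1 := by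
  rw [show a * b - c * d = a * (b - d) + (a - c) * d by ring]
  refine v.map_add_lt ?_ ?_
  · rw [map_mul]; exact mul_lt_of_le_one_of_lt ha h₂
  · rw [map_mul]; exact mul_lt_of_lt_of_le_one h₁ hd

theorem aeval_sub_aeval_lt_one (hk : ∀ c : k, v (algebraMap k Ω c) ≤ 1)
    {a e : Ω} (ha : v a ≤ 1) (h : v (a - e) < 1) (q : Polynomial k) :
    v (Polynomial.aeval a q - Polynomial.aeval e q) < 1 := by
  have he : v e ≤ 1 := by simpa using v.map_sub_le ha h.le
  have key (n : ℕ) : v (a ^ n - e ^ n) < 1 := by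
    induction n with
    | zero => simp
    | succ n ih =>
      simp only [pow_succ]
      exact mul_sub_mul_lt_one v ih h (by simpa using pow_le_one' ha n) he
  rw [Polynomial.aeval_eq_sum_range, Polynomial.aeval_eq_sum_range, ← Finset.sum_sub_distrib]
  refine v.map_sum_lt one_ne_zero fun i _ => ?_
  rw [← smul_sub, Algebra.smul_def, map_mul]
  exact mul_lt_of_le_one_of_lt (hk _) (key i)

/-- If a valuation is not nonnegative at `U`, the residue of an element algebraic over `k[U]` is
algebraic over `k`. -/
theorem exists_aeval_lt_one_of_isAlgebraic (hk : ∀ c : k, v (algebraMap k Ω c) ≤ 1)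
    {U e : Ω} (hU : 1 < v U) (he : v e ≤ 1)
    (halg : IsAlgebraic (Algebra.adjoin k {U}) e) :
    ∃ q : Polynomial k, q ≠ 0 ∧ v (Polynomial.aeval e q) < 1 := by
  by_contra! H
  have hle (c : Algebra.adjoin k {e}) : v (algebraMap _ Ω c) ≤ 1 := by
    obtain ⟨c, hc⟩ := c
    rw [Algebra.adjoin_singleton_eq_range_aeval] at hc
    obtain ⟨p, rfl⟩ := hc
    exact aeval_le_one v hk he p
  have hone (c : Algebra.adjoin k {e}) (h0 : c ≠ 0) : v (algebraMap _ Ω c) = 1 := by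
    refine le_antisymm (hle c) ?_
    obtain ⟨c, hc⟩ := c
    rw [Algebra.adjoin_singleton_eq_range_aeval] at hc
    obtain ⟨p, rfl⟩ := hc
    refine H p ?_
    rintro rfl
    exact h0 (Subtype.ext (map_zero (Polynomial.aeval e)))
  have htr : Transcendental k e := by
    rw [transcendental_iff]
    intro p hp
    by_contra h0
    simpa [hp] using H p h0
  have hUalg : IsAlgebraic (Algebra.adjoin k {e}) U := by
    by_contra hU'
    have hx : AlgebraicIndependent k (fun _ : Unit => e) :=
      algebraicIndependent_unique_type_iff.2 htr
    have h2 := (hx.option_iff_transcendental U).2 (by rwa [Set.range_const])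
    have h3 := h2.transcendental_adjoin (s := {none}) (i := some ()) (by simp)
    rw [Set.image_singleton] at h3
    exact h3 halg
  obtain ⟨P, hP, hPU⟩ := hUalg
  have := aeval_sub_leadingCoeff_lt v hle hU P
  rw [hPU, zero_sub, map_neg, map_mul, map_pow,
    hone _ (Polynomial.leadingCoeff_ne_zero.2 hP), one_mul] at this
  exact this.false

theorem multiset_prod_map_le {ι : Type*} (s : Multiset ι) (f g : ι → Ω)
    (h : ∀ i ∈ s, v (f i) ≤ v (g i)) : v (s.map f).prod ≤ v (s.map g).prod := by
  induction s using Multiset.induction_on with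
  | empty => simp
  | cons i s ih =>
    simp only [Multiset.map_cons, Multiset.prod_cons, map_mul]
    exact mul_le_mul' (h i (by simp)) (ih fun j hj => h j (by simp [hj]))

theorem multiset_prod_map_sub_le {ι : Type*} (s : Multiset ι) (f g : ι → Ω)
    (h : ∀ i ∈ s, v (f i - g i) < v (f i)) :
    v ((s.map f).prod - (s.map g).prod) < v (s.map f).prod := by
  induction s using Multiset.induction_on with
  | empty => simp
  | cons i s ih =>
    specialize ih fun j hj => h j (by simp [hj])
    specialize h i (by simp)
    simp only [Multiset.map_cons, Multiset.prod_cons]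
    have hg : v (g i) = v (f i) := v.map_eq_of_sub_lt (by rwa [v.map_sub_swap])
    rw [show ∀ a b c d : Ω, a * b - c * d = (a - c) * b + c * (b - d) by intros; ring]
    refine v.map_add_lt ?_ ?_
    · simp only [map_mul]
      exact mul_lt_mul_of_pos_right h (zero_le.trans_lt ih)
    · simp only [map_mul, hg]
      exact mul_lt_mul_of_pos_left ih (zero_le.trans_lt h)

/-- A valuation-theoretic maximum principle: if `f g ≡ 1` at `V`, then the value of `f` at `V` is
close to a value of `f` at an element algebraic over the coefficients. -/
theorem exists_isAlgebraic_sub_lt_one [IsAlgClosed Ω] {S : Type*} [CommRing S] [IsDomain S]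
    [Algebra S Ω] [FaithfulSMul S Ω] {V : Ω} (f g : Polynomial S)
    (hf : v (Polynomial.aeval V f) ≤ 1)
    (hfg : v (Polynomial.aeval V f * Polynomial.aeval V g - 1) < 1) :
    ∃ e : Ω, v (Polynomial.aeval V f - e) < 1 ∧ IsAlgebraic S e := by
  classical
  have split (p : Polynomial S) (z : Ω) : Polynomial.aeval z p =
      algebraMap S Ω p.leadingCoeff * ((p.aroots Ω).map (z - ·)).prod := by
    rw [← Polynomial.eval_map_algebraMap, (IsAlgClosed.splits _).eval_eq_prod_roots,
      Polynomial.leadingCoeff_map_of_injective (FaithfulSMul.algebraMap_injective S Ω)]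
  set h : Polynomial S := f * g - 1 with h_def
  have hh : v (Polynomial.aeval V h) < 1 := by simpa [h_def] using hfg
  rcases eq_or_ne (f.aroots Ω) 0 with hr | hr
  · refine ⟨Polynomial.aeval V f, by simp, ?_⟩
    rw [split f V, hr]
    simpa using isAlgebraic_algebraMap f.leadingCoeff
  obtain ⟨α, hα, hmin⟩ := (f.aroots Ω).toFinset.exists_min_image (fun α => v (V - α))
    (by simpa [Multiset.toFinset_nonempty] using hr)
  simp only [Multiset.mem_toFinset] at hα hmin
  have hαf : Polynomial.aeval α f = 0 := (Polynomial.mem_aroots.1 hα).2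
  have hhα : Polynomial.aeval α h = -1 := by simp [h_def, hαf]
  by_cases hβ : ∃ β ∈ h.aroots Ω, v (V - β) < v (V - α)
  · obtain ⟨β, hβ, hlt⟩ := hβ
    have hβa : IsAlgebraic S β := ⟨h, (Polynomial.mem_aroots.1 hβ)⟩
    refine ⟨Polynomial.aeval β f, ?_, ?_⟩
    · refine lt_of_lt_of_le ?_ hf
      have hfV : Polynomial.aeval V f ≠ 0 := by
        intro h0
        simp [h0] at hfg
      rw [split f V] at hfV ⊢
      rw [split f β, ← mul_sub, map_mul, map_mul]
      refine mul_lt_mul_of_pos_left (multiset_prod_map_sub_le v _ _ _ fun i hi => ?_) ?_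
      · rw [sub_sub_sub_cancel_right]
        exact hlt.trans_le (hmin i hi)
      · rw [v.pos_iff]
        exact left_ne_zero_of_mul hfV
    · rw [Polynomial.aeval_eq_sum_range]
      refine (Subalgebra.algebraicClosure S Ω).sum_mem fun i _ => ?_
      exact Subalgebra.smul_mem _ (Subalgebra.pow_mem _ hβa _) _
  · push Not at hβ
    have : v (Polynomial.aeval α h) ≤ v (Polynomial.aeval V h) := by
      rw [split h, split h, map_mul, map_mul]
      gcongr
      refine multiset_prod_map_le v _ _ _ fun β hb => ?_
      have := v.map_sub_le (hβ β hb) (le_refl (v (V - β)))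
      rw [show α - β = (V - β) - (V - α) by ring]
      exact v.map_sub_le le_rfl (hβ β hb)
    rw [hhα, map_neg, map_one] at this
    exact absurd hh this.not_gt

/-- Elements of `k[U, V]` which are invertible in the residue field of a valuation having a pole
on `k[U, V]`, with inverse represented in `k[U, V]`, have residues algebraic over `k`. -/
theorem exists_aeval_lt_one_of_mul_sub_one_lt [IsAlgClosed Ω]
    (hk : ∀ c : k, v (algebraMap k Ω c) ≤ 1)
    {U V a b : Ω} (hU : 1 < v U)
    (ha : a ∈ Algebra.adjoin k {U, V}) (hb : b ∈ Algebra.adjoin k {U, V}) (hva : v a ≤ 1)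
    (hab : v (a * b - 1) < 1) :
    ∃ q : Polynomial k, q ≠ 0 ∧ v (Polynomial.aeval a q) < 1 := by
  obtain ⟨f, rfl⟩ := exists_aeval_eq_of_mem_adjoin_pair ha
  obtain ⟨g, rfl⟩ := exists_aeval_eq_of_mem_adjoin_pair hb
  obtain ⟨e, hae, halg⟩ := exists_isAlgebraic_sub_lt_one v f g hva hab
  have he : v e ≤ 1 := by simpa using v.map_sub_le hva hae.le
  obtain ⟨q, hq, hqe⟩ := exists_aeval_lt_one_of_isAlgebraic v hk hU he halg
  exact ⟨q, hq, by simpa using v.map_add_lt (aeval_sub_aeval_lt_one v hk hva hae q) hqe⟩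

/-- If the residue of `F` is transcendental over `k`, an element of `k[U, V]` whose residue is a
rational function of that of `F` has a residue polynomial in that of `F`. -/
theorem exists_sub_aeval_lt_one_of_mem_adjoin [IsAlgClosed Ω]
    (hk : ∀ c : k, v (algebraMap k Ω c) ≤ 1)
    {F U V x : Ω} (hU : 1 < v U)
    (hFv : ∀ q : Polynomial k, q ≠ 0 → v (Polynomial.aeval F q) = 1)
    (hF : F ∈ Algebra.adjoin k {U, V}) (hx : x ∈ Algebra.adjoin k {U, V})
    {p q : Polynomial k} (hq : q ≠ 0)
    (hpq : v (Polynomial.aeval F q * x - Polynomial.aeval F p) < 1) :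
    ∃ P : Polynomial k, v (x - Polynomial.aeval F P) < 1 := by
  classical
  have hFle (q : Polynomial k) : v (Polynomial.aeval F q) ≤ 1 := by
    rcases eq_or_ne q 0 with rfl | h
    · simp
    · exact (hFv q h).le
  set d := EuclideanDomain.gcd p q
  obtain ⟨p', hp'⟩ : d ∣ p := EuclideanDomain.gcd_dvd_left p q
  obtain ⟨q', hq'⟩ : d ∣ q := EuclideanDomain.gcd_dvd_right p q
  have hd : d ≠ 0 := by
    rintro h0
    rw [hq', h0, zero_mul] at hq
    exact hq rfl
  obtain ⟨u, w, huw⟩ : ∃ u w, u * p' + w * q' = 1 := by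
    refine ⟨EuclideanDomain.gcdA p q, EuclideanDomain.gcdB p q, mul_left_cancel₀ hd ?_⟩
    have hgcd : d = p * _ + q * _ := EuclideanDomain.gcd_eq_gcd_ab p q
    linear_combination -hgcd - EuclideanDomain.gcdA p q * hp' - EuclideanDomain.gcdB p q * hq'
  have hpq' : v (Polynomial.aeval F q' * x - Polynomial.aeval F p') < 1 := by
    rw [hp', hq', map_mul, map_mul, mul_assoc, ← mul_sub, map_mul, hFv d hd, one_mul] at hpq
    exact hpq
  have hmem (r : Polynomial k) : Polynomial.aeval F r ∈ Algebra.adjoin k {U, V} :=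
    Algebra.adjoin_le (Set.singleton_subset_iff.2 hF) (Polynomial.aeval_mem_adjoin_singleton k F)
  have hab : v (Polynomial.aeval F q' * (Polynomial.aeval F u * x + Polynomial.aeval F w) - 1)
      < 1 := by
    have h1 := congrArg (Polynomial.aeval F) huw
    simp only [map_add, map_mul, map_one] at h1
    rw [← h1, show ∀ a b c d e : Ω, a * (b * x + c) - (b * d + c * a) = b * (a * x - d) by
      intros; ring, map_mul]
    · exact mul_lt_of_le_one_of_lt (hFle u) hpq'
    exact 0
  obtain ⟨Q, hQ, hQv⟩ := exists_aeval_lt_one_of_mul_sub_one_lt v hk hU (hmem q')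
    (add_mem (mul_mem (hmem u) hx) (hmem w)) (hFle q') hab
  have hcomp : Q.comp q' = 0 := by
    by_contra h0
    have := hFv _ h0
    rw [Polynomial.aeval_comp] at this
    exact hQv.ne this
  obtain ⟨c, rfl⟩ : ∃ c, q' = Polynomial.C c :=
    ⟨_, ((Polynomial.comp_eq_zero_iff.1 hcomp).resolve_left hQ).2⟩
  have hc : c ≠ 0 := by
    rintro rfl
    simp [hq'] at hq
  refine ⟨Polynomial.C c⁻¹ * p', ?_⟩
  have : x - Polynomial.aeval F (Polynomial.C c⁻¹ * p') =
      algebraMap k Ω c⁻¹ * (Polynomial.aeval F (Polynomial.C c) * x - Polynomial.aeval F p') := by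
    rw [mul_sub, ← mul_assoc, Polynomial.aeval_C, ← map_mul, inv_mul_cancel₀ hc]
    simp
  rw [this, map_mul]
  exact mul_lt_of_le_one_of_lt (hk _) hpq'

/-- If `x ∈ k(F, G)` has nonnegative valuation, where `v` has a pole at `G` and is trivial on
`k(F)`, the residue of `x` lies in `k(F)`. -/
theorem exists_aeval_mul_sub_aeval_lt_one {F G x : Ω} (hG : 1 < v G)
    (hFv : ∀ q : Polynomial k, q ≠ 0 → v (Polynomial.aeval F q) = 1)
    (hx : x ∈ IntermediateField.adjoin k {F, G}) (hvx : v x ≤ 1) :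
    ∃ p q : Polynomial k, q ≠ 0 ∧ v (Polynomial.aeval F q * x - Polynomial.aeval F p) < 1 := by
  rw [IntermediateField.mem_adjoin_iff_div] at hx
  obtain ⟨r, hr, s, hs, rfl⟩ := hx
  obtain ⟨P, rfl⟩ := exists_aeval_eq_of_mem_adjoin_pair hr
  obtain ⟨Q, rfl⟩ := exists_aeval_eq_of_mem_adjoin_pair hs
  have hone (c : Algebra.adjoin k {F}) (h0 : c ≠ 0) : v (algebraMap _ Ω c) = 1 := by
    obtain ⟨c, hc⟩ := c
    rw [Algebra.adjoin_singleton_eq_range_aeval] at hc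
    obtain ⟨p, rfl⟩ := hc
    refine hFv p ?_
    rintro rfl
    exact h0 (Subtype.ext (map_zero (Polynomial.aeval F)))
  have hle (c : Algebra.adjoin k {F}) : v (algebraMap _ Ω c) ≤ 1 := by
    rcases eq_or_ne c 0 with rfl | h
    · simp
    · exact (hone c h).le
  have hrep (c : Algebra.adjoin k {F}) : ∃ p : Polynomial k, algebraMap _ Ω c =
      Polynomial.aeval F p := by
    obtain ⟨c, hc⟩ := c
    rw [Algebra.adjoin_singleton_eq_range_aeval] at hc
    obtain ⟨p, rfl⟩ := hc
    exact ⟨p, rfl⟩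
  have hlead (P : Polynomial (Algebra.adjoin k {F})) (hP : P ≠ 0) :
      v (Polynomial.aeval G P) = v G ^ P.natDegree := by
    have h1 := aeval_sub_leadingCoeff_lt v hle hG P
    have h2 : v (algebraMap _ Ω P.leadingCoeff * G ^ P.natDegree) = v G ^ P.natDegree := by
      rw [map_mul, map_pow, hone _ (Polynomial.leadingCoeff_ne_zero.2 hP), one_mul]
    rw [← h2] at h1 ⊢
    exact v.map_eq_of_sub_lt h1
  have hGpos (n : ℕ) : 0 < v G ^ n := pow_pos (zero_lt_one.trans hG) n
  have hzero (h : v (Polynomial.aeval G P / Polynomial.aeval G Q) < 1) :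
      ∃ p q : Polynomial k, q ≠ 0 ∧ v (Polynomial.aeval F q *
        (Polynomial.aeval G P / Polynomial.aeval G Q) - Polynomial.aeval F p) < 1 :=
    ⟨0, 1, one_ne_zero, by simpa using h⟩
  rcases eq_or_ne P 0 with rfl | hP
  · exact hzero (by simp)
  rcases eq_or_ne Q 0 with rfl | hQ
  · exact hzero (by simp)
  rw [map_div₀, hlead P hP, hlead Q hQ, div_le_one₀ (hGpos _)] at hvx
  have hdeg := (pow_le_pow_iff_right₀ hG).1 hvx
  rcases hdeg.lt_or_eq with hlt | heq
  · refine hzero ?_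
    rw [map_div₀, hlead P hP, hlead Q hQ, div_lt_one₀ (hGpos _)]
    exact pow_lt_pow_right₀ hG hlt
  obtain ⟨p, hp⟩ := hrep P.leadingCoeff
  obtain ⟨q, hq⟩ := hrep Q.leadingCoeff
  refine ⟨p, q, ?_, ?_⟩
  · rintro rfl
    have := hone _ (Polynomial.leadingCoeff_ne_zero.2 hQ)
    simp [hq] at this
  have hP1 := aeval_sub_leadingCoeff_lt v hle hG P
  have hQ1 := aeval_sub_leadingCoeff_lt v hle hG Q
  have hQ0 : Polynomial.aeval G Q ≠ 0 := by
    rw [← v.pos_iff, hlead Q hQ]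
    exact hGpos _
  set x := Polynomial.aeval G P / Polynomial.aeval G Q with hx
  have hPx : Polynomial.aeval G P = x * Polynomial.aeval G Q := (div_mul_cancel₀ _ hQ0).symm
  have hvx1 : v x ≤ 1 := by
    rw [hx, map_div₀, hlead P hP, hlead Q hQ, heq, div_self (hGpos _).ne']
  rw [hp, heq, hPx] at hP1
  rw [hq] at hQ1
  refine lt_of_mul_lt_mul_right (a := v G ^ Q.natDegree) ?_ (hGpos _).le
  rw [one_mul, ← map_pow, ← map_mul, map_pow,
    show (Polynomial.aeval F q * x - Polynomial.aeval F p) * G ^ Q.natDegree =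
      (x * Polynomial.aeval G Q - Polynomial.aeval F p * G ^ Q.natDegree) -
      x * (Polynomial.aeval G Q - Polynomial.aeval F q * G ^ Q.natDegree) by ring]
  refine v.map_sub_lt hP1 ?_
  rw [map_mul]
  exact mul_lt_of_le_one_of_lt hvx1 hQ1

end Valuation

/-- Elements of an extension of `Frac A` which are not integral over a localization `M⁻¹A` of a
domain `A` are separated from it by a valuation ring. -/
theorem ValuationSubring.exists_notMem_of_forall_not_isIntegral_smul {A L Ω : Type*} [CommRing A]
    [IsDomain A] [Field L] [Algebra A L] [IsFractionRing A L] [Field Ω] [Algebra L Ω] [Algebra A Ω]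
    [IsScalarTower A L Ω] {M : Submonoid A} (hM : M ≤ nonZeroDivisors A) {x : Ω}
    (hx : ∀ m ∈ M, ¬ IsIntegral A (m • x)) :
    ∃ O : ValuationSubring Ω, (∀ a : A, O.valuation (algebraMap A Ω a) ≤ 1) ∧
      (∀ m ∈ M, O.valuation (algebraMap A Ω m) = 1) ∧ 1 < O.valuation x := by
  let B := Localization.subalgebra.ofField L M hM
  have hloc : IsLocalization M B := Localization.subalgebra.isLocalization_ofField L M hM
  have : IsScalarTower A B Ω := inferInstance
  let R : Subring Ω := (integralClosure B Ω).toSubring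
  have hxR : x ∉ R := fun h => by
    obtain ⟨⟨m, hm⟩, hint⟩ := IsIntegral.exists_multiple_integral_of_isLocalization M x h
    exact hx m hm hint
  have hcl : IsIntegrallyClosedIn R Ω :=
    inferInstanceAs (IsIntegrallyClosedIn (integralClosure B Ω) Ω)
  obtain ⟨O, hRO, hxO⟩ := Subring.exists_le_valuationSubring_of_isIntegrallyClosedIn hxR
  have hBO (b : B) : O.valuation (algebraMap B Ω b) ≤ 1 :=
    (O.valuation_le_one_iff _).2 (hRO (isIntegral_algebraMap : IsIntegral B (algebraMap B Ω b)))
  refine ⟨O, fun a => ?_, fun m hm => ?_, ?_⟩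
  · rw [IsScalarTower.algebraMap_apply A B Ω]
    exact hBO _
  · rw [IsScalarTower.algebraMap_apply A B Ω]
    obtain ⟨u, hu⟩ := IsLocalization.map_units B (⟨m, hm⟩ : M)
    change ↑u = algebraMap A B m at hu
    rw [← hu]
    refine le_antisymm (hBO _) ?_
    have h1 : O.valuation (algebraMap B Ω u) * O.valuation (algebraMap B Ω ↑u⁻¹) = 1 := by
      rw [← map_mul, ← map_mul, Units.mul_inv, map_one, map_one]
    rw [← h1]
    exact mul_le_of_le_one_right' (hBO _)
  · rw [← not_le]
    exact fun h => hxO ((O.valuation_le_one_iff _).1 h)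

section FractionField

variable {k L : Type} [Field k] [Field L] [Algebra (MvPolynomial (Fin 2) k) L]
  [IsFractionRing (MvPolynomial (Fin 2) k) L] [Algebra k L]
  [IsScalarTower k (MvPolynomial (Fin 2) k) L]

variable (k L) in
theorem two_le_trdeg_of_isFractionRing : 2 ≤ Algebra.trdeg k L := by
  have h : Function.Injective (IsScalarTower.toAlgHom k (MvPolynomial (Fin 2) k) L) :=
    IsFractionRing.injective (MvPolynomial (Fin 2) k) L
  simpa [MvPolynomial.trdeg_of_isDomain] using trdeg_le_of_injective _ h

/-- Two elements over which the fraction field of `k[X, Y]` is algebraic are algebraically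
independent. -/
theorem algebraicIndependent_pair {a b : L}
    (hab : Algebra.IsAlgebraic (Algebra.adjoin k {a, b}) L) : AlgebraicIndependent k ![a, b] := by
  have hr : Set.range ![a, b] = {a, b} := by simp [Matrix.range_cons, Set.pair_comm]
  rw [← hr] at hab
  refine (Algebra.IsAlgebraic.isTranscendenceBasis_of_le_trdeg_of_finite k ![a, b] ?_).1
  simpa using two_le_trdeg_of_isFractionRing k L

theorem algebraicIndependent_pair_of_adjoin_eq_top {a b : L}
    (hab : IntermediateField.adjoin k {a, b} = ⊤) : AlgebraicIndependent k ![a, b] := by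
  refine algebraicIndependent_pair ⟨fun x => ?_⟩
  have hx : x ∈ IntermediateField.adjoin k {a, b} := hab ▸ IntermediateField.mem_top
  obtain ⟨r, hr, s, hs, rfl⟩ := IntermediateField.mem_adjoin_iff_div.1 hx
  rw [div_eq_mul_inv]
  exact (isAlgebraic_algebraMap (⟨r, hr⟩ : Algebra.adjoin k {a, b})).mul
    (isAlgebraic_algebraMap (⟨s, hs⟩ : Algebra.adjoin k {a, b})).inv

theorem transcendental_of_adjoin_eq_top {a b : L}
    (hab : IntermediateField.adjoin k {a, b} = ⊤) : Transcendental k a :=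
  (algebraicIndependent_pair_of_adjoin_eq_top hab).transcendental 0

/-- A bad field generator `F` admits a valuation, nonnegative on `k[X, Y]` and trivial on `k(F)`,
with a pole at a prescribed complementary generator. -/
theorem exists_valuationSubring_of_bad {Ω : Type} [Field Ω] [Algebra L Ω]
    {F : MvPolynomial (Fin 2) k} {g : L}
    (hg : IntermediateField.adjoin k {algebraMap (MvPolynomial (Fin 2) k) L F, g} = ⊤)
    (hbad : ¬ ∃ G : MvPolynomial (Fin 2) k, IntermediateField.adjoin k
      {algebraMap (MvPolynomial (Fin 2) k) L F, algebraMap (MvPolynomial (Fin 2) k) L G} = ⊤) :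
    ∃ O : ValuationSubring Ω,
      (∀ a : MvPolynomial (Fin 2) k, O.valuation (algebraMap L Ω (algebraMap _ L a)) ≤ 1) ∧
      (∀ q : Polynomial k, q ≠ 0 →
        O.valuation (algebraMap L Ω (algebraMap _ L (Polynomial.aeval F q))) = 1) ∧
      1 < O.valuation (algebraMap L Ω g) := by
  let _ : Algebra (MvPolynomial (Fin 2) k) Ω :=
    ((algebraMap L Ω).comp (algebraMap (MvPolynomial (Fin 2) k) L)).toAlgebra
  have : IsScalarTower (MvPolynomial (Fin 2) k) L Ω := .of_algebraMap_eq fun _ => rfl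
  have hFt : Transcendental k F := by
    have := transcendental_of_adjoin_eq_top hg
    rwa [transcendental_algebraMap_iff (IsFractionRing.injective _ L)] at this
  let M : Submonoid (MvPolynomial (Fin 2) k) :=
    (nonZeroDivisors (Polynomial k)).map (Polynomial.aeval F)
  have hM : M ≤ nonZeroDivisors (MvPolynomial (Fin 2) k) := by
    rintro _ ⟨q, hq, rfl⟩
    rw [mem_nonZeroDivisors_iff_ne_zero]
    exact fun h => nonZeroDivisors.ne_zero hq (transcendental_iff.1 hFt q h)
  suffices hx : ∀ m ∈ M, ¬ IsIntegral (MvPolynomial (Fin 2) k) (m • algebraMap L Ω g) by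
    obtain ⟨O, h1, h2, h3⟩ :=
      ValuationSubring.exists_notMem_of_forall_not_isIntegral_smul (L := L) hM hx
    exact ⟨O, h1, fun q hq => h2 _ ⟨q, mem_nonZeroDivisors_of_ne_zero hq, rfl⟩, h3⟩
  rintro _ ⟨q, hq, rfl⟩ hint
  have hint' : IsIntegral (MvPolynomial (Fin 2) k) ((Polynomial.aeval F) q • g) := by
    refine (isIntegral_algebraMap_iff (algebraMap L Ω).injective).1 ?_
    rwa [Algebra.smul_def, map_mul, ← IsScalarTower.algebraMap_apply, ← Algebra.smul_def]
  obtain ⟨G, hG⟩ := IsIntegrallyClosed.isIntegral_iff.1 hint'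
  refine hbad ⟨G, ?_⟩
  rw [eq_top_iff, ← hg, IntermediateField.adjoin_le_iff]
  rintro z (rfl | rfl)
  · exact IntermediateField.subset_adjoin _ _ (by simp)
  set K := IntermediateField.adjoin k {algebraMap (MvPolynomial (Fin 2) k) L F, algebraMap _ L G}
  have hFK : algebraMap _ L F ∈ K := IntermediateField.subset_adjoin _ _ (by simp)
  have hGK : algebraMap _ L G ∈ K := IntermediateField.subset_adjoin _ _ (by simp)
  have hqK : algebraMap _ L (Polynomial.aeval F q) ∈ K := by
    rw [← Polynomial.aeval_algebraMap_apply]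
    exact Algebra.adjoin_le (S := K.toSubalgebra) (Set.singleton_subset_iff.2 hFK)
      (Polynomial.aeval_mem_adjoin_singleton k _)
  have hq0 : algebraMap _ L (Polynomial.aeval F q) ≠ 0 := by
    rw [Ne, FaithfulSMul.algebraMap_eq_zero_iff]
    exact nonZeroDivisors.ne_zero (hM ⟨q, hq, rfl⟩)
  rw [Algebra.smul_def] at hG
  rw [SetLike.mem_coe, eq_div_of_mul_eq hq0 ((mul_comm _ _).trans hG.symm)]
  exact div_mem hGK hqK

end FractionField

theorem Subalgebra.exists_eq_adjoin_pair_of_algEquiv {k R : Type*} [CommRing k] [CommRing R]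
    [Algebra k R] {C : Subalgebra k R} (e : C ≃ₐ[k] MvPolynomial (Fin 2) k) :
    ∃ U V : R, C = Algebra.adjoin k {U, V} := by
  refine ⟨e.symm (X 0), e.symm (X 1), ?_⟩
  have h : (C.val.comp e.symm.toAlgHom).range = C := by
    ext z
    refine ⟨?_, fun hz => ⟨e ⟨z, hz⟩, by simp⟩⟩
    rintro ⟨p, rfl⟩
    exact (e.symm p).2
  refine h.symm.trans ?_
  rw [← Algebra.map_top, ← MvPolynomial.adjoin_range_X, AlgHom.map_adjoin, ← Set.range_comp]
  congr 1
  ext z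
  simp [Fin.exists_fin_two, eq_comm]

section Residue

variable {k L Ω Γ : Type*} [Field k] [Field L] [Algebra k L] [Field Ω] [Algebra L Ω] [Algebra k Ω]
  [IsScalarTower k L Ω] [IsAlgClosed Ω] [LinearOrderedCommGroupWithZero Γ] (v : Valuation Ω Γ)

/-- If `f` is a good field generator of a polynomial ring `C` in two variables, and `v` is a
valuation trivial on `k(f)` with a pole at a complementary generator in `C`, then elements of `C`
in the valuation ring have residues polynomial in that of `f`. -/
theorem Valuation.exists_sub_aeval_lt_one_of_generator (hk : ∀ c : k, v (algebraMap k Ω c) ≤ 1)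
    {C : Subalgebra k L} (e : C ≃ₐ[k] MvPolynomial (Fin 2) k) {f g x : L}
    (hfg : IntermediateField.adjoin k {f, g} = ⊤)
    (hfv : ∀ q : Polynomial k, q ≠ 0 → v (algebraMap L Ω (Polynomial.aeval f q)) = 1)
    (hgv : 1 < v (algebraMap L Ω g)) (hf : f ∈ C) (hg : g ∈ C) (hx : x ∈ C)
    (hxv : v (algebraMap L Ω x) ≤ 1) :
    ∃ P : Polynomial k, v (algebraMap L Ω (x - Polynomial.aeval f P)) < 1 := by
  obtain ⟨U, V, hC⟩ := C.exists_eq_adjoin_pair_of_algEquiv e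
  wlog hU : 1 < v (algebraMap L Ω U) generalizing U V
  · refine this V U (by rw [hC, Set.pair_comm]) ?_
    by_contra hV
    rw [not_lt] at hU hV
    refine hgv.not_ge ?_
    rw [hC] at hg
    clear this hfg hgv
    induction hg using Algebra.adjoin_induction with
    | mem z hz =>
      rcases hz with rfl | rfl
      exacts [hU, hV]
    | algebraMap c => rw [← IsScalarTower.algebraMap_apply]; exact hk c
    | add a b _ _ ha hb => rw [map_add]; exact v.map_add_le ha hb
    | mul a b _ _ ha hb => rw [map_mul, map_mul]; exact mul_le_one' ha hb
  have hmem {z : L} (hz : z ∈ C) :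
      algebraMap L Ω z ∈ Algebra.adjoin k {algebraMap L Ω U, algebraMap L Ω V} := by
    rw [← Set.image_pair, ← IsScalarTower.coe_toAlgHom' k L Ω, ← AlgHom.map_adjoin, ← hC]
    exact ⟨z, hz, rfl⟩
  have hfv' (q : Polynomial k) (hq : q ≠ 0) :
      v (Polynomial.aeval (algebraMap L Ω f) q) = 1 := by
    rw [Polynomial.aeval_algebraMap_apply]
    exact hfv q hq
  have hxa : algebraMap L Ω x ∈
      IntermediateField.adjoin k {algebraMap L Ω f, algebraMap L Ω g} := by
    rw [← Set.image_pair, ← IsScalarTower.coe_toAlgHom' k L Ω, ← IntermediateField.adjoin_map, hfg]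
    exact ⟨x, IntermediateField.mem_top, rfl⟩
  obtain ⟨p, q, hq, hpq⟩ := v.exists_aeval_mul_sub_aeval_lt_one hgv hfv' hxa hxv
  obtain ⟨P, hP⟩ :=
    v.exists_sub_aeval_lt_one_of_mem_adjoin hk hU hfv' (hmem hf) (hmem hx) hq hpq
  refine ⟨P, ?_⟩
  rwa [_root_.map_sub, ← Polynomial.aeval_algebraMap_apply]

end Residue

section FractionField

variable {k L : Type} [Field k] [Field L] [Algebra (MvPolynomial (Fin 2) k) L]
  [IsFractionRing (MvPolynomial (Fin 2) k) L] [Algebra k L]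
  [IsScalarTower k (MvPolynomial (Fin 2) k) L]

theorem exists_aeval_eq_X_of_good {F X' Y' : MvPolynomial (Fin 2) k}
    (hbad : ¬ ∃ G : MvPolynomial (Fin 2) k, IntermediateField.adjoin k
      {algebraMap (MvPolynomial (Fin 2) k) L F, algebraMap (MvPolynomial (Fin 2) k) L G} = ⊤)
    {C : Subalgebra k L} (e : C ≃ₐ[k] MvPolynomial (Fin 2) k)
    (hC : ∀ a : MvPolynomial (Fin 2) k, algebraMap _ L a ∈ C)
    (hdiv : algebraMap (MvPolynomial (Fin 2) k) L Y' / algebraMap _ L X' ∈ C)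
    {g : L} (hg : IntermediateField.adjoin k {algebraMap (MvPolynomial (Fin 2) k) L F, g} = ⊤)
    (hgC : g ∈ C) :
    ∃ x y : Polynomial k, aeval ![x, y] F = Polynomial.X ∧
      (aeval ![x, y] X' ≠ 0 → aeval ![x, y] X' ∣ aeval ![x, y] Y') := by
  let Ω := AlgebraicClosure L
  obtain ⟨O, hA, hFv, hgv⟩ := exists_valuationSubring_of_bad (Ω := Ω) hg hbad
  set v := O.valuation
  have hk (c : k) : v (algebraMap k Ω c) ≤ 1 := by
    have := hA (algebraMap k _ c)
    rwa [← IsScalarTower.algebraMap_apply, ← IsScalarTower.algebraMap_apply] at this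
  have hFv' (q : Polynomial k) (hq : q ≠ 0) :
      v (algebraMap L Ω (Polynomial.aeval (algebraMap _ L F) q)) = 1 := by
    rw [Polynomial.aeval_algebraMap_apply]
    exact hFv q hq
  have hzero (q : Polynomial k)
      (hq : v (algebraMap L Ω (algebraMap _ L (Polynomial.aeval F q))) < 1) : q = 0 := by
    by_contra h0
    exact hq.ne (hFv q h0)
  have hres {z : L} (hz : z ∈ C) (hzv : v (algebraMap L Ω z) ≤ 1) :
      ∃ P : Polynomial k, v (algebraMap L Ω (z - algebraMap _ L (Polynomial.aeval F P))) < 1 := by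
    simpa only [Polynomial.aeval_algebraMap_apply] using
      v.exists_sub_aeval_lt_one_of_generator hk e hg hFv' hgv (hC F) hgC hz hzv
  obtain ⟨x, hx⟩ := hres (hC (X 0)) (hA _)
  obtain ⟨y, hy⟩ := hres (hC (X 1)) (hA _)
  have hcong (p : MvPolynomial (Fin 2) k) : v (algebraMap L Ω (algebraMap _ L p) -
      algebraMap L Ω (algebraMap _ L (Polynomial.aeval F (aeval ![x, y] p)))) < 1 := by
    induction p using MvPolynomial.induction_on with
    | C a => simp [MvPolynomial.algebraMap_eq]
    | add p q hp hq =>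
      simp only [map_add]
      rw [add_sub_add_comm]
      exact v.map_add_lt hp hq
    | mul_X p i hp =>
      simp only [map_mul]
      refine v.mul_sub_mul_lt_one hp ?_ (hA _) (hA _)
      fin_cases i
      · simpa using hx
      · simpa using hy
  refine ⟨x, y, ?_, fun hx' => ?_⟩
  · refine (sub_eq_zero.1 (hzero _ ?_)).symm
    simpa using hcong F
  have hX1 : v (algebraMap L Ω (algebraMap _ L X')) = 1 := by
    rw [← hFv _ hx']
    refine v.map_eq_of_sub_lt ?_
    rw [hFv _ hx']
    exact hcong X'
  have hX0 : algebraMap (MvPolynomial (Fin 2) k) L X' ≠ 0 := fun h => by simp [h] at hX1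
  obtain ⟨z, hz⟩ := hres hdiv (by simpa [map_div₀, hX1] using hA Y')
  refine ⟨z, sub_eq_zero.1 (hzero _ ?_)⟩
  have h1 := v.map_sub_lt (hcong Y')
    (v.mul_sub_mul_lt_one (hcong X') (by rwa [map_sub] at hz) (hA _) (hA _))
  rw [← v.map_neg]
  convert h1 using 2
  have : algebraMap L Ω (algebraMap _ L Y') = algebraMap L Ω (algebraMap _ L X') *
      algebraMap L Ω (algebraMap _ L Y' / algebraMap _ L X') := by
    rw [← map_mul, mul_div_cancel₀ _ hX0]
  simp only [map_sub, map_mul]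
  rw [this]
  ring

end FractionField

section Curves

variable {k : Type*} [Field k]

theorem natDegree_aeval_pair_eq_zero (F : MvPolynomial (Fin 2) k) {s t : Polynomial k}
    (hs : s.natDegree = 0) (ht : t.natDegree = 0) : (aeval ![s, t] F).natDegree = 0 := by
  obtain ⟨a, rfl⟩ := Polynomial.natDegree_eq_zero.1 hs
  obtain ⟨b, rfl⟩ := Polynomial.natDegree_eq_zero.1 ht
  have h : (![Polynomial.C a, Polynomial.C b] : Fin 2 → Polynomial k) =
      algebraMap k (Polynomial k) ∘ ![a, b] := by
    ext i; fin_cases i <;> simp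
  rw [h, MvPolynomial.aeval_algebraMap_apply]
  exact Polynomial.natDegree_C _

/-- Either `F` does not involve the second variable, or the degree of `F` along curves `(s, t)` with
`t` of large degree compared to `s` is at least that of `t`. -/
theorem exists_natDegree_le_natDegree_aeval_pair (F : MvPolynomial (Fin 2) k) :
    (∃ f : Polynomial k, F = Polynomial.aeval (X 0) f) ∨
    ∃ e : ℕ, ∀ s t : Polynomial k, s.natDegree ≠ 0 → e * s.natDegree < t.natDegree →
      t.natDegree ≤ (aeval ![s, t] F).natDegree := by
  obtain ⟨P, rfl⟩ := (Polynomial.Bivariate.equivMvPolynomial k).surjective F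
  rcases Nat.eq_zero_or_pos P.natDegree with hP | hP
  · obtain ⟨f, rfl⟩ := Polynomial.natDegree_eq_zero.1 hP
    exact .inl ⟨f, Polynomial.aevalAeval_C _ _ f⟩
  refine .inr ⟨(Finset.range P.natDegree).sup fun i => (P.coeff i).natDegree, fun s t hs ht => ?_⟩
  set e := (Finset.range P.natDegree).sup fun i => (P.coeff i).natDegree
  have heval : aeval ![s, t] (Polynomial.Bivariate.equivMvPolynomial k P) =
      ∑ i ∈ Finset.range (P.natDegree + 1), (P.coeff i).comp s * t ^ i := by
    have h : ∀ P : Polynomial (Polynomial k),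
        aeval ![s, t] (Polynomial.Bivariate.equivMvPolynomial k P) =
        P.eval₂ (Polynomial.compRingHom s) t := by
      intro P
      induction P using Polynomial.induction_on' with
      | add p q hp hq => simp only [map_add, hp, hq, Polynomial.eval₂_add]
      | monomial n a =>
        have ha : Polynomial.Bivariate.equivMvPolynomial k (Polynomial.C a) =
            Polynomial.aeval (X 0) a := Polynomial.aevalAeval_C _ _ a
        rw [← Polynomial.C_mul_X_pow_eq_monomial, map_mul, map_mul, map_pow, map_pow, ha,
          ← Polynomial.aeval_algHom_apply]
        simp [Polynomial.comp_eq_aeval]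
    rw [h, Polynomial.eval₂_eq_sum_range]
    rfl
  have hs' : 0 < s.natDegree := Nat.pos_of_ne_zero hs
  have ht0 : t ≠ 0 := by
    rintro rfl
    simp at ht
  have htop : P.natDegree * t.natDegree ≤
      ((P.coeff P.natDegree).comp s * t ^ P.natDegree).natDegree := by
    rw [Polynomial.natDegree_mul, Polynomial.natDegree_pow]
    · exact Nat.le_add_left _ _
    · intro h
      rcases Polynomial.comp_eq_zero_iff.1 h with h | ⟨-, h⟩
      · rw [Polynomial.coeff_natDegree, Polynomial.leadingCoeff_eq_zero] at h
        simp [h] at hP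
      · rw [h] at hs
        simp at hs
    · exact pow_ne_zero _ ht0
  have hpos : 0 < P.natDegree * t.natDegree := Nat.mul_pos hP (by omega)
  have hlow : (∑ i ∈ Finset.range P.natDegree, (P.coeff i).comp s * t ^ i).natDegree <
      P.natDegree * t.natDegree := by
    refine lt_of_le_of_lt (Polynomial.natDegree_sum_le_of_forall_le _ _
      (n := P.natDegree * t.natDegree - 1) fun i hi => ?_) (by omega)
    have hie : (P.coeff i).natDegree ≤ e :=
      Finset.le_sup (f := fun i => (P.coeff i).natDegree) hi
    have h1 : ((P.coeff i).comp s * t ^ i).natDegree ≤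
        (P.coeff i).natDegree * s.natDegree + i * t.natDegree := by
      refine Polynomial.natDegree_mul_le.trans ?_
      rw [Polynomial.natDegree_comp, Polynomial.natDegree_pow]
    have h2 := Nat.mul_le_mul_right s.natDegree hie
    have h3 : (i + 1) * t.natDegree ≤ P.natDegree * t.natDegree :=
      Nat.mul_le_mul_right _ (Finset.mem_range.1 hi)
    rw [add_mul, one_mul] at h3
    omega
  rw [heval, Finset.sum_range_succ, Polynomial.natDegree_add_eq_right_of_natDegree_lt
    (hlow.trans_le htop)]
  exact (Nat.le_mul_of_pos_left _ hP).trans htop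

/-- For a suitable pair of exponents, no curve on which `F` restricts to a coordinate has the first
coordinate `x + (y + x ^ n) ^ N` dividing the second one `y + x ^ n`. -/
theorem exists_not_dvd_of_aeval_pair_eq_X {F : MvPolynomial (Fin 2) k}
    (hF : ∀ f : Polynomial k, F = Polynomial.aeval (X 0) f → f.natDegree ≠ 1) :
    ∃ n N : ℕ, ∀ x y : Polynomial k, aeval ![x, y] F = Polynomial.X →
      ¬ (x + (y + x ^ n) ^ N ≠ 0 → x + (y + x ^ n) ^ N ∣ y + x ^ n) := by
  rcases exists_natDegree_le_natDegree_aeval_pair F with ⟨f, hf⟩ | ⟨e, he⟩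
  · refine ⟨0, 0, fun x y hxy => ?_⟩
    rw [hf, ← Polynomial.aeval_algHom_apply, aeval_X, Matrix.cons_val_zero,
      ← Polynomial.comp_eq_aeval] at hxy
    have := congrArg Polynomial.natDegree hxy
    rw [Polynomial.natDegree_comp, Polynomial.natDegree_X] at this
    exact absurd (Nat.eq_one_of_mul_eq_one_right this) (hF f hf)
  set n := e + 2 with hn
  set F₁ : MvPolynomial (Fin 2) k := aeval ![X 1, X 0 - X 1 ^ n] F with hF₁
  have heval (a b : Polynomial k) : aeval ![a, b] F₁ = aeval ![b, a - b ^ n] F := by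
    rw [hF₁, MvPolynomial.comp_aeval_apply]
    congr 2
    ext i
    fin_cases i <;> simp
  rcases exists_natDegree_le_natDegree_aeval_pair F₁ with ⟨f, hf⟩ | ⟨e₁, he₁⟩
  · exfalso
    have h1 := heval 0 Polynomial.X
    rw [hf, ← Polynomial.aeval_algHom_apply, aeval_X, Matrix.cons_val_zero,
      ← Polynomial.comp_eq_aeval, zero_sub] at h1
    have h2 := he Polynomial.X (-Polynomial.X ^ n) (by simp) (by simp [hn])
    rw [← h1] at h2
    simp [hn] at h2
  refine ⟨n, e₁ + 2, fun x y hxy hdvd => ?_⟩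
  have hconst (hx : x.natDegree = 0) (hy : y.natDegree = 0) : False := by
    have := natDegree_aeval_pair_eq_zero F hx hy
    simp [hxy] at this
  set y' := y + x ^ n with hy'
  have hyy : y = y' - x ^ n := (add_sub_cancel_right _ _).symm
  have hy0 : y' ≠ 0 := by
    intro h0
    rw [h0, zero_sub] at hyy
    have hx : x.natDegree ≠ 0 := fun h => hconst h (by simp [hyy, h])
    have := he x y hx (by
      rw [hyy, Polynomial.natDegree_neg, Polynomial.natDegree_pow]
      exact Nat.mul_lt_mul_of_pos_right (by omega) (Nat.pos_of_ne_zero hx))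
    rw [hxy, Polynomial.natDegree_X, hyy, Polynomial.natDegree_neg,
      Polynomial.natDegree_pow] at this
    have h3 := Nat.le_mul_of_pos_right n (Nat.pos_of_ne_zero hx)
    omega
  set x' := x + y' ^ (e₁ + 2) with hx'
  have hxx : x = x' - y' ^ (e₁ + 2) := (add_sub_cancel_right _ _).symm
  have hdeg : x'.natDegree ≤ y'.natDegree := by
    rcases eq_or_ne x' 0 with h | h
    · simp [h]
    · exact Polynomial.natDegree_le_of_dvd (hdvd h) hy0
  rcases Nat.eq_zero_or_pos y'.natDegree with hb | hb
  · have hx : x.natDegree = 0 := by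
      have := Polynomial.natDegree_sub_le x' (y' ^ (e₁ + 2))
      rw [← hxx, Polynomial.natDegree_pow, hb] at this
      omega
    refine hconst hx ?_
    have := Polynomial.natDegree_sub_le y' (x ^ n)
    rw [← hyy, Polynomial.natDegree_pow, hx, hb] at this
    omega
  have hx : x.natDegree = (e₁ + 2) * y'.natDegree := by
    rw [hxx, Polynomial.natDegree_sub_eq_right_of_natDegree_lt, Polynomial.natDegree_pow]
    rw [Polynomial.natDegree_pow]
    nlinarith
  have := he₁ y' x hb.ne' (by rw [hx]; nlinarith)
  rw [heval, ← hyy, hxy, Polynomial.natDegree_X, hx] at this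
  nlinarith

/-- The triangular-type automorphism `X ↦ X + (Y + X ^ n) ^ N`, `Y ↦ Y + X ^ n`. -/
theorem bijective_aeval_add_pow (n N : ℕ) :
    Function.Bijective (aeval (R := k)
      ![X 0 + (X 1 + X 0 ^ n) ^ N, (X 1 + X 0 ^ n : MvPolynomial (Fin 2) k)]) := by
  refine Function.bijective_iff_has_inverse.2
    ⟨aeval ![X 0 - X 1 ^ N, X 1 - (X 0 - X 1 ^ N) ^ n], ?_, ?_⟩ <;>
  · intro p
    rw [← AlgHom.comp_apply]
    refine (AlgHom.congr_fun (φ₂ := AlgHom.id k _) ?_ p)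
    ext i
    fin_cases i <;> simp

end Curves

theorem algebraMap_mem_of_surjective_aeval {k L : Type} [Field k] [Field L]
    [Algebra (MvPolynomial (Fin 2) k) L] [Algebra k L]
    [IsScalarTower k (MvPolynomial (Fin 2) k) L] {p q : MvPolynomial (Fin 2) k}
    (hpq : Function.Surjective (aeval (R := k) ![p, q])) {S : Subalgebra k L}
    (hp : algebraMap _ L p ∈ S) (hq : algebraMap _ L q ∈ S) (a : MvPolynomial (Fin 2) k) :
    algebraMap _ L a ∈ S := by
  obtain ⟨b, rfl⟩ := hpq a
  induction b using MvPolynomial.induction_on with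
  | C c =>
    rw [aeval_C, ← IsScalarTower.algebraMap_apply]
    exact S.algebraMap_mem c
  | add b c hb hc => rw [map_add, map_add]; exact add_mem hb hc
  | mul_X b i hb =>
    rw [map_mul, map_mul, aeval_X]
    refine mul_mem hb ?_
    fin_cases i
    exacts [hp, hq]

section FractionField

variable {k L : Type} [Field k] [Field L] [Algebra (MvPolynomial (Fin 2) k) L]
  [IsFractionRing (MvPolynomial (Fin 2) k) L] [Algebra k L]
  [IsScalarTower k (MvPolynomial (Fin 2) k) L]

theorem natDegree_ne_one_of_bad {F : MvPolynomial (Fin 2) k}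
    (hbad : ¬ ∃ G : MvPolynomial (Fin 2) k, IntermediateField.adjoin k
      {algebraMap (MvPolynomial (Fin 2) k) L F, algebraMap (MvPolynomial (Fin 2) k) L G} = ⊤)
    (f : Polynomial k) (hf : F = Polynomial.aeval (X 0) f) : f.natDegree ≠ 1 := by
  intro h
  obtain ⟨a, ha, b, rfl⟩ := Polynomial.natDegree_eq_one.1 h
  refine hbad ⟨X 1, ?_⟩
  set K := IntermediateField.adjoin k
    {algebraMap (MvPolynomial (Fin 2) k) L F, algebraMap (MvPolynomial (Fin 2) k) L (X 1)}
  have hFK : algebraMap _ L F ∈ K := IntermediateField.subset_adjoin _ _ (by simp)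
  have h1K : algebraMap (MvPolynomial (Fin 2) k) L (X 1) ∈ K :=
    IntermediateField.subset_adjoin _ _ (by simp)
  have h0K : algebraMap (MvPolynomial (Fin 2) k) L (X 0) ∈ K := by
    have : (X 0 : MvPolynomial (Fin 2) k) = C a⁻¹ * (F - C b) := by
      rw [hf]
      simp [MvPolynomial.algebraMap_eq, ← mul_assoc, ← C_mul, inv_mul_cancel₀ ha]
    rw [this, map_mul, map_sub, ← MvPolynomial.algebraMap_eq, ← IsScalarTower.algebraMap_apply,
      ← IsScalarTower.algebraMap_apply]
    exact mul_mem (K.algebraMap_mem _) (sub_mem hFK (K.algebraMap_mem _))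
  have hX : Function.Surjective (aeval (R := k) ![(X 0 : MvPolynomial (Fin 2) k), X 1]) := by
    intro p
    refine ⟨p, AlgHom.congr_fun (φ₂ := AlgHom.id k _) ?_ p⟩
    ext i
    fin_cases i <;> simp
  have hK := algebraMap_mem_of_surjective_aeval (S := K.toSubalgebra) hX h0K h1K
  rw [eq_top_iff]
  rintro z -
  obtain ⟨p, q, -, rfl⟩ := IsFractionRing.div_surjective (A := MvPolynomial (Fin 2) k) z
  exact div_mem (hK p) (hK q)

/-- If `(X', Y')` are coordinates of `A = k[X, Y]`, then `k[X', Y'/X']` is a polynomial ring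
containing `A`. -/
theorem algebraMap_mem_adjoin_div_and_nonempty_algEquiv {X' Y' : MvPolynomial (Fin 2) k}
    (h : Function.Bijective (aeval (R := k) ![X', Y'])) :
    (∀ a : MvPolynomial (Fin 2) k, algebraMap _ L a ∈
      Algebra.adjoin k {algebraMap _ L X', algebraMap _ L Y' / algebraMap _ L X'}) ∧
    Nonempty (Algebra.adjoin k {algebraMap (MvPolynomial (Fin 2) k) L X',
      algebraMap _ L Y' / algebraMap _ L X'} ≃ₐ[k] MvPolynomial (Fin 2) k) := by
  set u := algebraMap (MvPolynomial (Fin 2) k) L X' with hu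
  set w := algebraMap (MvPolynomial (Fin 2) k) L Y' / u with hw
  have hX0 : u ≠ 0 := by
    rw [hu, Ne, FaithfulSMul.algebraMap_eq_zero_iff]
    have h1 := h.1.ne (X_ne_zero (R := k) (0 : Fin 2))
    simpa using h1
  have huC : u ∈ Algebra.adjoin k {u, w} := Algebra.subset_adjoin (by simp)
  have hwC : w ∈ Algebra.adjoin k {u, w} := Algebra.subset_adjoin (by simp)
  have hmem := algebraMap_mem_of_surjective_aeval h.2 (S := Algebra.adjoin k {u, w}) huC (by
    rw [← mul_div_cancel₀ (algebraMap (MvPolynomial (Fin 2) k) L Y') hX0]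
    exact mul_mem huC hwC)
  refine ⟨hmem, ?_⟩
  have hind : AlgebraicIndependent k ![u, w] := by
    refine algebraicIndependent_pair ⟨fun x => ?_⟩
    obtain ⟨p, q, -, rfl⟩ := IsFractionRing.div_surjective (A := MvPolynomial (Fin 2) k) x
    rw [div_eq_mul_inv]
    exact (isAlgebraic_algebraMap (⟨_, hmem p⟩ : Algebra.adjoin k {u, w})).mul
      (isAlgebraic_algebraMap (⟨_, hmem q⟩ : Algebra.adjoin k {u, w})).inv
  have hr : Set.range ![u, w] = {u, w} := by simp [Matrix.range_cons, Set.pair_comm]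
  rw [← hr]
  exact ⟨hind.aevalEquiv.symm⟩

end FractionField

/-- A field generator `F` of `A = k[X,Y]` is bad if and only if there is a
polynomial ring `A'` with `A ⊆ A' ⊆ Frac A`, `Frac A' = Frac A`, such that `F` is a very
bad field generator of `A'`; moreover, in that case there is a coordinate system `(X',Y')`
of `A` such that `F` is a very bad field generator of `k[X', Y'/X']`. -/
theorem stmt19 (k : Type) [Field k] (L : Type) [Field L]
    [Algebra (MvPolynomial (Fin 2) k) L] [IsFractionRing (MvPolynomial (Fin 2) k) L]
    [Algebra k L] [IsScalarTower k (MvPolynomial (Fin 2) k) L]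
    (F : MvPolynomial (Fin 2) k)
    (hFG : ∃ g : L, IntermediateField.adjoin k
        {algebraMap (MvPolynomial (Fin 2) k) L F, g} = ⊤) :
    ((¬ ∃ G : MvPolynomial (Fin 2) k, IntermediateField.adjoin k
          {algebraMap (MvPolynomial (Fin 2) k) L F,
           algebraMap (MvPolynomial (Fin 2) k) L G} = ⊤)
      ↔ ∃ B : Subalgebra k L,
          Set.range (algebraMap (MvPolynomial (Fin 2) k) L) ⊆ (B : Set L) ∧
          Nonempty (B ≃ₐ[k] MvPolynomial (Fin 2) k) ∧
          VeryBadIn k B (algebraMap (MvPolynomial (Fin 2) k) L F))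
    ∧ ((¬ ∃ G : MvPolynomial (Fin 2) k, IntermediateField.adjoin k
          {algebraMap (MvPolynomial (Fin 2) k) L F,
           algebraMap (MvPolynomial (Fin 2) k) L G} = ⊤) →
        ∃ X' Y' : MvPolynomial (Fin 2) k,
          Function.Bijective ⇑(MvPolynomial.aeval (R := k) ![X', Y']) ∧
          VeryBadIn k
            (Algebra.adjoin k
              ({algebraMap (MvPolynomial (Fin 2) k) L X',
                algebraMap (MvPolynomial (Fin 2) k) L Y'
                  / algebraMap (MvPolynomial (Fin 2) k) L X'} : Set L))
            (algebraMap (MvPolynomial (Fin 2) k) L F)) := by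
  have hex : (¬ ∃ G : MvPolynomial (Fin 2) k, IntermediateField.adjoin k
      {algebraMap (MvPolynomial (Fin 2) k) L F,
       algebraMap (MvPolynomial (Fin 2) k) L G} = ⊤) →
      ∃ X' Y' : MvPolynomial (Fin 2) k,
        Function.Bijective ⇑(MvPolynomial.aeval (R := k) ![X', Y']) ∧
        VeryBadIn k
          (Algebra.adjoin k
            ({algebraMap (MvPolynomial (Fin 2) k) L X',
              algebraMap (MvPolynomial (Fin 2) k) L Y'
                / algebraMap (MvPolynomial (Fin 2) k) L X'} : Set L))
          (algebraMap (MvPolynomial (Fin 2) k) L F) := by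
    intro hbad
    obtain ⟨n, N, hnN⟩ := exists_not_dvd_of_aeval_pair_eq_X (natDegree_ne_one_of_bad hbad)
    have hbij := bijective_aeval_add_pow (k := k) n N
    refine ⟨_, _, hbij, fun B hB ⟨e⟩ _ => ⟨hFG, ?_⟩⟩
    rintro ⟨g, hgB, hg⟩
    obtain ⟨x, y, hxy, hdvd⟩ := exists_aeval_eq_X_of_good hbad e
      (fun a => hB ((algebraMap_mem_adjoin_div_and_nonempty_algEquiv hbij).1 a))
      (hB (Algebra.subset_adjoin (Set.mem_insert_of_mem _ rfl))) hg hgB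
    exact hnN x y hxy (by simpa using hdvd)
  refine ⟨⟨fun hbad => ?_, ?_⟩, hex⟩
  · obtain ⟨X', Y', hbij, hvb⟩ := hex hbad
    obtain ⟨hmem, hequiv⟩ := algebraMap_mem_adjoin_div_and_nonempty_algEquiv (L := L) hbij
    exact ⟨_, Set.range_subset_iff.2 hmem, hequiv, hvb⟩
  · rintro ⟨B, hAB, he, hvb⟩ ⟨G, hG⟩
    refine (hvb B le_rfl he fun x => ?_).2 ⟨_, hAB ⟨G, rfl⟩, hG⟩
    obtain ⟨p, q, hq, rfl⟩ := IsFractionRing.div_surjective (A := MvPolynomial (Fin 2) k) x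
    have hq0 : algebraMap _ L q ≠ 0 := by
      rw [Ne, FaithfulSMul.algebraMap_eq_zero_iff]
      exact nonZeroDivisors.ne_zero hq
    exact ⟨⟨_, hAB ⟨p, rfl⟩⟩, ⟨_, hAB ⟨q, rfl⟩⟩, fun h => hq0 (congrArg Subtype.val h),
      div_mul_cancel₀ _ hq0⟩
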